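/- For every positive integer d with d ≥ 2 there exist constants C and n₀ depending only on d such that the following holds for all n ≥ n₀. Let 𝓕 ⊆ binom([n], d+1) be a family with VC-dimension at most d. Then there exist a set V ⊆ [n] with |V| = n−2, a partition of 𝓕 into three pairwise disjoint families 𝓕¹, 𝓕², 𝓕³, and a function f from 𝓕³ to the real vector space of functions 𝓢 → ℝ, where 𝓢 = binom(V, d−1) ∪ (binom(V, d) \ ∂̄𝓕³), such that: (i) |𝓕¹ ∪ 𝓕²| ≤ 0.1·|∂̄𝓕| + C·n^{d−2}, and |{D ∈ ∂̄𝓖 : D ⊆ V}| ≥ (1 − 8d/n)·|∂̄𝓖| where 𝓖 = 𝓕² ∪ 𝓕³; (ii) for each F ∈ 𝓕³, either f(F) = e_S for some S ∈ 𝓢, or f(F) = (1/2)e_S + (1/2)e_{S′} for some distinct S, S′ ∈ 𝓢, where e_S denotes the indicator function of {S}; (iii) for every S ∈ 𝓢, the sum over F ∈ 𝓕³ of f(F)(S) is at most 1. -/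

import Mathlib

open Finset

/-- `S` is shattered by the family `𝓕`. -/
def Shatters' {n : ℕ} (𝓕 : Finset (Finset (Fin n))) (S : Finset (Fin n)) : Prop :=
  ∀ A ⊆ S, ∃ F ∈ 𝓕, F ∩ S = A

/-- The VC-dimension of `𝓕` is at most `d`. -/
def VCDimLE {n : ℕ} (𝓕 : Finset (Finset (Fin n))) (d : ℕ) : Prop :=
  ∀ S : Finset (Fin n), Shatters' 𝓕 S → S.card ≤ d

/-- `T` is a `𝓖`-certificate of `F`: a proper subset of `F` such that no member of `𝓖`
meets `F` exactly in `T`. -/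
def IsCert {n : ℕ} (𝓖 : Finset (Finset (Fin n))) (F T : Finset (Fin n)) : Prop :=
  T ⊂ F ∧ ∀ F' ∈ 𝓖, F' ∩ F ≠ T

/-- `c` assigns to each member of `𝓖` a maximum `𝓖`-certificate. -/
def IsMaxCertAssignment {n : ℕ} (𝓖 : Finset (Finset (Fin n)))
    (c : Finset (Fin n) → Finset (Fin n)) : Prop :=
  ∀ F ∈ 𝓖, IsCert 𝓖 F (c F) ∧ ∀ T : Finset (Fin n), IsCert 𝓖 F T → T.card ≤ (c F).card

/-- The shadow `∂𝓗`: all sets obtained from a member of `𝓗` by removing one element. -/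
def shadow' {n : ℕ} (𝓗 : Finset (Finset (Fin n))) : Finset (Finset (Fin n)) :=
  Finset.univ.filter (fun S => ∃ F ∈ 𝓗, S ⊆ F ∧ S.card + 1 = F.card)

/-- `∂̄𝓗 = binom([n], d) \ ∂𝓗`. -/
def compShadow {n : ℕ} (d : ℕ) (𝓗 : Finset (Finset (Fin n))) : Finset (Finset (Fin n)) :=
  Finset.powersetCard d (Finset.univ : Finset (Fin n)) \ shadow' 𝓗

/-- The index family `𝓢 = binom(V, d−1) ∪ (binom(V, d) \ ∂̄𝓗)`. -/
def famS {n : ℕ} (d : ℕ) (V : Finset (Fin n)) (𝓗 : Finset (Finset (Fin n))) :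
    Finset (Finset (Fin n)) :=
  Finset.powersetCard (d - 1) V ∪ (Finset.powersetCard d V \ compShadow d 𝓗)

section Certificates

variable {n d : ℕ} {𝓕 : Finset (Finset (Fin n))} {c : Finset (Fin n) → Finset (Fin n)}

lemma exists_isMaxCertAssignment (hcard : ∀ F ∈ 𝓕, F.card = d + 1) (hvc : VCDimLE 𝓕 d) :
    ∃ c, IsMaxCertAssignment 𝓕 c := by
  classical
  have key : ∀ F ∈ 𝓕, ∃ T, IsCert 𝓕 F T ∧ ∀ T', IsCert 𝓕 F T' → T'.card ≤ T.card := by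
    intro F hF
    have hns : ¬ Shatters' 𝓕 F := by
      intro h
      have := hvc F h
      have := hcard F hF
      omega
    have hne : (Finset.univ.filter (fun T => IsCert 𝓕 F T)).Nonempty := by
      unfold Shatters' at hns
      push Not at hns
      obtain ⟨A, hA, h⟩ := hns
      refine ⟨A, ?_⟩
      simp only [mem_filter, mem_univ, true_and]
      refine ⟨Finset.ssubset_iff_subset_ne.2 ⟨hA, ?_⟩, h⟩
      rintro rfl
      exact h A hF (Finset.inter_self _)
    obtain ⟨T, hT, hmax⟩ := Finset.exists_max_image _ Finset.card hne
    simp only [mem_filter, mem_univ, true_and] at hT hmax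
    exact ⟨T, hT, hmax⟩
  choose! c hc using key
  exact ⟨c, hc⟩

lemma cert_subset (hc : IsMaxCertAssignment 𝓕 c) {F : Finset (Fin n)} (hF : F ∈ 𝓕) :
    c F ⊆ F := (hc F hF).1.1.subset

lemma exists_mem_of_cert_subset (hc : IsMaxCertAssignment 𝓕 c) {F G : Finset (Fin n)}
    (hF : F ∈ 𝓕) (hG : G ∈ 𝓕) (h : c F ⊆ G) : ∃ a ∈ G, a ∈ F ∧ a ∉ c F := by
  by_contra! hcon
  refine (hc F hF).1.2 G hG (Finset.Subset.antisymm ?_ ?_)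
  · intro a ha
    rw [mem_inter] at ha
    exact hcon a ha.1 ha.2
  · exact Finset.subset_inter h (cert_subset hc hF)

/-- A certificate of size `d` lies in a unique member of the family. -/
lemma eq_of_cert_subset (hcard : ∀ F ∈ 𝓕, F.card = d + 1) (hc : IsMaxCertAssignment 𝓕 c)
    {F G : Finset (Fin n)} (hF : F ∈ 𝓕) (hG : G ∈ 𝓕) (hd : (c F).card = d) (h : c F ⊆ G) :
    G = F := by
  obtain ⟨a, haG, haF, hac⟩ := exists_mem_of_cert_subset hc hF hG h
  have h1 : insert a (c F) ⊆ F := insert_subset haF (cert_subset hc hF)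
  have h2 : insert a (c F) ⊆ G := insert_subset haG h
  have h3 : (insert a (c F)).card = d + 1 := by rw [card_insert_of_notMem hac, hd]
  rw [← eq_of_subset_of_card_le h1 (by rw [h3, hcard F hF]),
    ← eq_of_subset_of_card_le h2 (by rw [h3, hcard G hG])]

open Classical in
lemma card_fiber_superset_le (hcard : ∀ F ∈ 𝓕, F.card = d + 1) (hc : IsMaxCertAssignment 𝓕 c)
    (T : Finset (Fin n)) (m : ℕ) : ∀ Y : Finset (Fin n), T ⊆ Y → d + 1 ≤ Y.card + m →
      (𝓕.filter (fun F => c F = T ∧ Y ⊆ F)).card ≤ (d + 1) ^ m := by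
  induction m with
  | zero =>
    intro Y _ hYc
    rw [pow_zero, card_le_one]
    intro F hF G hG
    simp only [mem_filter] at hF hG
    rw [← eq_of_subset_of_card_le hF.2.2 (by rw [hcard F hF.1]; omega),
      ← eq_of_subset_of_card_le hG.2.2 (by rw [hcard G hG.1]; omega)]
  | succ m ih =>
    intro Y hTY hYc
    by_cases hex : ∃ G ∈ 𝓕, G ∩ Y = T
    · obtain ⟨G, hG, hGY⟩ := hex
      have hsub : 𝓕.filter (fun F => c F = T ∧ Y ⊆ F) ⊆
          (G \ Y).biUnion (fun a => 𝓕.filter (fun F => c F = T ∧ insert a Y ⊆ F)) := by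
        intro F hF
        simp only [mem_filter] at hF
        obtain ⟨hF, rfl, hYF⟩ := hF
        obtain ⟨a, haG, haF, hac⟩ := exists_mem_of_cert_subset hc hF hG
          (hGY ▸ Finset.inter_subset_left)
        simp only [mem_biUnion, mem_filter, mem_sdiff]
        refine ⟨a, ⟨haG, fun haY => hac ?_⟩, hF, trivial, insert_subset haF hYF⟩
        rw [← hGY]
        exact mem_inter.2 ⟨haG, haY⟩
      refine (card_le_card hsub).trans ((card_biUnion_le_card_mul _ _ ((d + 1) ^ m) ?_).trans ?_)
      · intro a ha
        rw [mem_sdiff] at ha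
        refine ih _ (hTY.trans (subset_insert _ _)) ?_
        rw [card_insert_of_notMem ha.2]
        omega
      · rw [pow_succ, mul_comm]
        refine Nat.mul_le_mul_left _ ?_
        rw [← hcard G hG]
        exact card_le_card sdiff_subset
    · refine le_trans (b := 1) ?_ (Nat.one_le_pow _ _ (by omega))
      have heq : ∀ F ∈ 𝓕.filter (fun F => c F = T ∧ Y ⊆ F), F = Y := by
        intro F hF
        simp only [mem_filter] at hF
        obtain ⟨hF, rfl, hYF⟩ := hF
        by_contra hne
        have hcY : ¬ Y ⊆ c F := fun h => hex ⟨F, hF, by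
          rw [Finset.Subset.antisymm h hTY, inter_eq_right]
          exact cert_subset hc hF⟩
        obtain ⟨b, hbY, hbc⟩ := Finset.not_subset.1 hcY
        obtain ⟨a, haF, haY⟩ : ∃ a ∈ F, a ∉ Y :=
          Finset.not_subset.1 fun h => hne (Finset.Subset.antisymm h hYF)
        have hcert : IsCert 𝓕 F (F \ (Y \ c F)) := by
          refine ⟨Finset.ssubset_iff_subset_ne.2 ⟨sdiff_subset, fun h => ?_⟩, ?_⟩
          · have : b ∈ F \ (Y \ c F) := h.symm.subset (hYF hbY)
            simp [hbY, hbc] at this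
          · intro G hG hGF
            refine hex ⟨G, hG, ?_⟩
            ext e
            have := congrArg (e ∈ ·) hGF
            simp only [mem_inter, mem_sdiff, eq_iff_iff] at this
            have h1 := @hTY e
            have h2 := @hYF e
            simp only [mem_inter]
            tauto
        have hlt : (c F).card < (F \ (Y \ c F)).card := by
          refine card_lt_card (Finset.ssubset_iff_of_subset ?_ |>.2 ⟨a, ?_, fun h => haY (hTY h)⟩)
          · intro e he
            simp [he, cert_subset hc hF he]
          · simp [haF, haY]
        exact absurd ((hc F hF).2 _ hcert) (by omega)
      rw [card_le_one]
      intro F hF G hG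
      rw [heq F hF, heq G hG]

open Classical in
lemma card_fiber_le (hcard : ∀ F ∈ 𝓕, F.card = d + 1) (hc : IsMaxCertAssignment 𝓕 c)
    (T : Finset (Fin n)) : (𝓕.filter (fun F => c F = T)).card ≤ (d + 1) ^ (d + 1) := by
  refine (card_le_card ?_).trans (card_fiber_superset_le hcard hc T (d + 1) T subset_rfl (by omega))
  intro F hF
  simp only [mem_filter] at hF ⊢
  exact ⟨hF.1, hF.2, hF.2 ▸ cert_subset hc hF.1⟩

open Classical in
lemma card_filter_cert_mem_le (hcard : ∀ F ∈ 𝓕, F.card = d + 1) (hc : IsMaxCertAssignment 𝓕 c)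
    (𝓣 : Finset (Finset (Fin n))) :
    (𝓕.filter (fun F => c F ∈ 𝓣)).card ≤ 𝓣.card * (d + 1) ^ (d + 1) := by
  have hsub : 𝓕.filter (fun F => c F ∈ 𝓣) ⊆ 𝓣.biUnion (fun T => 𝓕.filter (fun F => c F = T)) := by
    intro F hF
    simp only [mem_filter, mem_biUnion] at hF ⊢
    exact ⟨c F, hF.2, hF.1, rfl⟩
  exact (card_le_card hsub).trans (card_biUnion_le_card_mul _ _ _ fun T _ => card_fiber_le hcard hc T)

end Certificates

lemma card_powersetCard_univ_le (n k : ℕ) :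
    (powersetCard k (univ : Finset (Fin n))).card ≤ n ^ k := by
  rw [card_powersetCard, card_univ, Fintype.card_fin]
  exact Nat.choose_le_pow _ _

lemma card_filter_card_le_le {n : ℕ} (hn : 1 ≤ n) (k : ℕ) :
    ((univ : Finset (Finset (Fin n))).filter (fun T => T.card ≤ k)).card ≤ (k + 1) * n ^ k := by
  have hsub : (univ : Finset (Finset (Fin n))).filter (fun T => T.card ≤ k) ⊆
      (range (k + 1)).biUnion (fun i => powersetCard i univ) := by
    intro T hT
    simp only [mem_filter, mem_univ, true_and] at hT
    simp only [mem_biUnion, mem_range, mem_powersetCard, subset_univ, true_and]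
    exact ⟨T.card, by omega, rfl⟩
  refine (card_le_card hsub).trans ((card_biUnion_le_card_mul _ _ (n ^ k) ?_).trans (by simp))
  intro i hi
  rw [mem_range] at hi
  exact (card_powersetCard_univ_le n i).trans (Nat.pow_le_pow_right hn (by omega))

open Classical in
/-- Few points have much more than the average degree. -/
lemma card_high_degree_le {n : ℕ} {ι : Type*} (I : Finset ι) (A : ι → Finset (Fin n)) (a m : ℕ)
    (hA : ∀ i ∈ I, (A i).card ≤ a) :
    ((univ : Finset (Fin n)).filter
      (fun x => m * (a * I.card) < n * (I.filter (fun i => x ∈ A i)).card)).card * m ≤ n := by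
  set X := (univ : Finset (Fin n)).filter
      (fun x => m * (a * I.card) < n * (I.filter (fun i => x ∈ A i)).card) with hX
  have hsum : ∑ x ∈ X, (I.filter (fun i => x ∈ A i)).card ≤ a * I.card := by
    calc ∑ x ∈ X, (I.filter (fun i => x ∈ A i)).card
        ≤ ∑ x, (I.filter (fun i => x ∈ A i)).card :=
          sum_le_sum_of_subset (subset_univ _)
      _ = ∑ i ∈ I, (univ.filter (fun x => x ∈ A i)).card := by
          simp only [card_filter]
          exact sum_comm
      _ ≤ ∑ i ∈ I, a := sum_le_sum fun i hi => by simpa using hA i hi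
      _ = a * I.card := by simp [mul_comm]
  have h1 : X.card * (m * (a * I.card)) ≤ n * (a * I.card) := by
    calc X.card * (m * (a * I.card)) = ∑ x ∈ X, m * (a * I.card) := by simp
      _ ≤ ∑ x ∈ X, n * (I.filter (fun i => x ∈ A i)).card := by
          refine sum_le_sum fun x hx => ?_
          rw [hX, mem_filter] at hx
          exact hx.2.le
      _ ≤ n * (a * I.card) := by
          rw [← mul_sum]
          exact Nat.mul_le_mul_left _ hsum
  rcases Nat.eq_zero_or_pos (a * I.card) with h0 | h0
  · have : X = ∅ := by
      rw [Finset.eq_empty_iff_forall_notMem]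
      intro x hx
      have h2 : (I.filter (fun i => x ∈ A i)).card ≤ ∑ x ∈ X, (I.filter (fun i => x ∈ A i)).card :=
        single_le_sum (f := fun x => (I.filter (fun i => x ∈ A i)).card)
          (fun _ _ => Nat.zero_le _) hx
      rw [hX, mem_filter] at hx
      have h3 : (I.filter (fun i => x ∈ A i)).card = 0 := by omega
      rw [h3] at hx
      omega
    simp [this]
  · rw [← mul_assoc] at h1
    exact Nat.le_of_mul_le_mul_right h1 h0

section Conflicts

variable {n d : ℕ} {𝓕 : Finset (Finset (Fin n))} {c : Finset (Fin n) → Finset (Fin n)}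

/-- At most `K` of the `d`-sets containing `T` are missing from the shadow of `𝓕`. -/
def IsFull (d K : ℕ) (𝓕 : Finset (Finset (Fin n))) (T : Finset (Fin n)) : Prop :=
  ((compShadow d 𝓕).filter (fun D => T ⊆ D)).card ≤ K

lemma exists_superset_of_notMem_compShadow (hcard : ∀ F ∈ 𝓕, F.card = d + 1)
    {D : Finset (Fin n)} (hD : D.card = d) (h : D ∉ compShadow d 𝓕) :
    ∃ G ∈ 𝓕, ∃ w, w ∉ D ∧ G = insert w D := by
  simp only [compShadow, shadow', mem_sdiff, mem_powersetCard, subset_univ, true_and, hD,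
    mem_filter, mem_univ, not_not] at h
  obtain ⟨G, hG, hDG, -⟩ := h
  obtain ⟨w, hw, hwG⟩ := exists_eq_insert_iff.2 ⟨hDG, by rw [hcard G hG, hD]⟩
  exact ⟨G, hG, w, hw, hwG.symm⟩

open Classical in
lemma card_missing_extension_le {K : ℕ} {T : Finset (Fin n)} (h : IsFull d K 𝓕 T) :
    ((univ : Finset (Fin n)).filter
      (fun s => s ∉ T ∧ insert s T ∈ compShadow d 𝓕)).card ≤ K := by
  refine le_trans (card_le_card_of_injOn (fun s => insert s T) ?_ ?_) h
  · intro s hs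
    simp only [coe_filter, mem_univ, true_and, Set.mem_ofPred_eq] at hs
    simp only [coe_filter, Set.mem_ofPred_eq]
    exact ⟨hs.2, subset_insert _ _⟩
  · intro s hs t ht hst
    simp only [coe_filter, mem_univ, true_and, Set.mem_ofPred_eq] at hs ht
    have h1 : s ∈ insert t T := by
      have : s ∈ insert s T := mem_insert_self _ _
      simpa only [hst] using this
    rcases mem_insert.1 h1 with h2 | h2
    · exact h2
    · exact absurd h2 hs.1

/-- Two members of `𝓕` of the form `R ∪ {t, v, u}` and `R ∪ {t, v, u'}`, with certificates
`R ∪ {t}` and `R ∪ {v}` that are both nearly full. -/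
structure IsConflict (d K : ℕ) (𝓕 : Finset (Finset (Fin n)))
    (c : Finset (Fin n) → Finset (Fin n)) (R : Finset (Fin n)) (t v u u' : Fin n) : Prop where
  card_add : R.card + 2 = d
  t_notMem : t ∉ R
  v_notMem : v ∉ R
  u_notMem : u ∉ R
  u'_notMem : u' ∉ R
  t_ne_v : t ≠ v
  t_ne_u : t ≠ u
  t_ne_u' : t ≠ u'
  v_ne_u : v ≠ u
  v_ne_u' : v ≠ u'
  u_ne_u' : u ≠ u'
  left_mem : insert u (insert v (insert t R)) ∈ 𝓕
  right_mem : insert u' (insert v (insert t R)) ∈ 𝓕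
  cert_left : c (insert u (insert v (insert t R))) = insert t R
  cert_right : c (insert u' (insert v (insert t R))) = insert v R
  full_left : IsFull d K 𝓕 (insert t R)
  full_right : IsFull d K 𝓕 (insert v R)

namespace IsConflict

variable {K : ℕ} {R : Finset (Fin n)} {t v u u' : Fin n}

lemma hit_left (h : IsConflict d K 𝓕 c R t v u u') (hc : IsMaxCertAssignment 𝓕 c)
    {G : Finset (Fin n)} (hG : G ∈ 𝓕) (hRG : R ⊆ G) (ht : t ∈ G) : u ∈ G ∨ v ∈ G := by
  obtain ⟨a, haG, haF, hac⟩ := exists_mem_of_cert_subset hc h.left_mem hG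
    (by rw [h.cert_left]; exact insert_subset ht hRG)
  rw [h.cert_left] at hac
  simp only [mem_insert] at haF hac
  rcases haF with rfl | rfl | h1
  · exact Or.inl haG
  · exact Or.inr haG
  · exact absurd h1 hac

lemma hit_right (h : IsConflict d K 𝓕 c R t v u u') (hc : IsMaxCertAssignment 𝓕 c)
    {G : Finset (Fin n)} (hG : G ∈ 𝓕) (hRG : R ⊆ G) (hv : v ∈ G) : u' ∈ G ∨ t ∈ G := by
  obtain ⟨a, haG, haF, hac⟩ := exists_mem_of_cert_subset hc h.right_mem hG
    (by rw [h.cert_right]; exact insert_subset hv hRG)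
  rw [h.cert_right] at hac
  simp only [mem_insert] at haF hac
  rcases haF with rfl | rfl | rfl | h1
  · exact Or.inl haG
  · tauto
  · exact Or.inr haG
  · tauto

lemma generic {s w z z' : Fin n} (h : IsConflict d K 𝓕 c R t v u u')
    (hs : IsConflict d K 𝓕 c R s w z z') (hcard : ∀ F ∈ 𝓕, F.card = d + 1)
    (hc : IsMaxCertAssignment 𝓕 c) (hst : s ≠ t) (hsv : s ≠ v) (hsu : s ≠ u) (hsu' : s ≠ u')
    (h1 : insert s (insert t R) ∉ compShadow d 𝓕)
    (h2 : insert s (insert v R) ∉ compShadow d 𝓕)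
    (hwt : w ≠ t) (hwv : w ≠ v) (hwu : w ≠ u) (hwu' : w ≠ u') : z = t ∨ z = v := by
  have e1 := h.card_add
  have e2 := h.t_notMem
  have e3 := h.v_notMem
  have e4 := h.u_notMem
  have e5 := h.u'_notMem
  have e6 := hs.t_notMem
  have e7 := hs.v_notMem
  have e8 := hs.u_notMem
  have e9 := h.t_ne_v
  have e10 := h.t_ne_u
  have e11 := h.v_ne_u'
  have e12 := h.u_ne_u'
  have e13 := hs.t_ne_v
  have e14 := hs.t_ne_u
  obtain ⟨G, hG, x, -, rfl⟩ := exists_superset_of_notMem_compShadow hcard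
    (by rw [card_insert_of_notMem (by simp [hst, e6]), card_insert_of_notMem e2]; omega) h1
  obtain ⟨G', hG', y, -, rfl⟩ := exists_superset_of_notMem_compShadow hcard
    (by rw [card_insert_of_notMem (by simp [hsv, e6]), card_insert_of_notMem e3]; omega) h2
  have a1 := h.hit_left hc hG (fun e he => by simp [he]) (by simp)
  have a2 := hs.hit_left hc hG (fun e he => by simp [he]) (by simp)
  have a3 := h.hit_right hc hG' (fun e he => by simp [he]) (by simp)
  have a4 := hs.hit_left hc hG' (fun e he => by simp [he]) (by simp)
  simp only [mem_insert] at a1 a2 a3 a4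
  grind

end IsConflict

open Classical in
lemma card_conflict_partner_le (hcard : ∀ F ∈ 𝓕, F.card = d + 1) (hc : IsMaxCertAssignment 𝓕 c)
    {K : ℕ} (R : Finset (Fin n)) (w : Fin n) :
    ((univ : Finset (Fin n)).filter (fun s => ∃ z z', IsConflict d K 𝓕 c R s w z z')).card ≤
      (d + 1) ^ (d + 1) * (d + 1) := by
  have hsub : (univ : Finset (Fin n)).filter (fun s => ∃ z z', IsConflict d K 𝓕 c R s w z z') ⊆
      (𝓕.filter (fun F => c F = insert w R)).biUnion id := by
    intro s hs
    simp only [mem_filter, mem_univ, true_and] at hs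
    obtain ⟨z, z', h⟩ := hs
    simp only [mem_biUnion, mem_filter, id]
    exact ⟨_, ⟨h.right_mem, h.cert_right⟩, by simp⟩
  refine (card_le_card hsub).trans ((card_biUnion_le_card_mul _ _ (d + 1) ?_).trans ?_)
  · intro F hF
    exact (hcard F (mem_filter.1 hF).1).le
  · exact Nat.mul_le_mul_right _ (card_fiber_le hcard hc _)

open Classical in
lemma card_conflict_le (hcard : ∀ F ∈ 𝓕, F.card = d + 1) (hc : IsMaxCertAssignment 𝓕 c)
    {K : ℕ} (R : Finset (Fin n)) :
    ((univ : Finset (Fin n)).filter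
      (fun s => ∃ w z z', IsConflict d K 𝓕 c R s w z z')).card ≤
      10 + 4 * K + 10 * ((d + 1) ^ (d + 1) * (d + 1)) := by
  set W := (d + 1) ^ (d + 1) * (d + 1) with hW
  set N := (univ : Finset (Fin n)).filter
      (fun s => ∃ w z z', IsConflict d K 𝓕 c R s w z z') with hN
  by_contra! hlt
  have hdata : ∀ s ∈ N, ∃ w z z', IsConflict d K 𝓕 c R s w z z' := by
    intro s hs
    simpa [hN] using hs
  choose! v u u' hv using hdata
  let P : Fin n → Finset (Fin n) := fun w =>
    (univ : Finset (Fin n)).filter (fun s => ∃ z z', IsConflict d K 𝓕 c R s w z z')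
  let Mi : Finset (Fin n) → Finset (Fin n) := fun T => (univ : Finset (Fin n)).filter
      (fun s => s ∉ T ∧ insert s T ∈ compShadow d 𝓕)
  have hP : ∀ w, (P w).card ≤ W := fun w => card_conflict_partner_le hcard hc R w
  have hPmem : ∀ s ∈ N, s ∈ P (v s) := fun s hs => by
    simp only [P, mem_filter, mem_univ, true_and]
    exact ⟨_, _, hv s hs⟩
  let X : Fin n → Finset (Fin n) := fun t =>
    {t, v t, u t, u' t} ∪ (Mi (insert t R) ∪ Mi (insert (v t) R)) ∪
      ((P t ∪ P (v t)) ∪ (P (u t) ∪ P (u' t)))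
  have hX : ∀ t ∈ N, (X t).card ≤ 4 + 2 * K + 4 * W := by
    intro t ht
    have m1 : (Mi (insert t R)).card ≤ K := card_missing_extension_le (hv t ht).full_left
    have m2 : (Mi (insert (v t) R)).card ≤ K := card_missing_extension_le (hv t ht).full_right
    have m3 : ({t, v t, u t, u' t} : Finset (Fin n)).card ≤ 4 := card_le_four
    have p1 := hP t
    have p2 := hP (v t)
    have p3 := hP (u t)
    have p4 := hP (u' t)
    have q1 := card_union_le (P t) (P (v t))
    have q2 := card_union_le (P (u t)) (P (u' t))
    have q3 := card_union_le (P t ∪ P (v t)) (P (u t) ∪ P (u' t))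
    have q4 := card_union_le (Mi (insert t R)) (Mi (insert (v t) R))
    have q5 := card_union_le ({t, v t, u t, u' t} : Finset (Fin n))
      (Mi (insert t R) ∪ Mi (insert (v t) R))
    have q6 := card_union_le ({t, v t, u t, u' t} ∪ (Mi (insert t R) ∪ Mi (insert (v t) R)))
      ((P t ∪ P (v t)) ∪ (P (u t) ∪ P (u' t)))
    simp only [X]
    omega
  have hgen : ∀ t ∈ N, ∀ s ∈ N, s ∉ X t → u s = t ∨ u s = v t := by
    intro t ht s hs hsX
    have hsP := hPmem s hs
    have hsR := (hv s hs).t_notMem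
    simp only [X, mem_union, not_or, mem_insert, mem_singleton] at hsX
    obtain ⟨⟨⟨a1, a2, a3, a4⟩, b1, b2⟩, ⟨c1, c2⟩, c3, c4⟩ := hsX
    simp only [Mi, mem_filter, mem_univ, true_and, mem_insert, not_or, not_and] at b1 b2
    refine (hv t ht).generic (hv s hs) hcard hc a1 a2 a3 a4 (b1 ⟨a1, hsR⟩) (b2 ⟨a2, hsR⟩)
      ?_ ?_ ?_ ?_
    · rintro h
      exact c1 (h ▸ hsP)
    · rintro h
      exact c2 (h ▸ hsP)
    · rintro h
      exact c3 (h ▸ hsP)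
    · rintro h
      exact c4 (h ▸ hsP)
  obtain ⟨t₁, ht₁⟩ : N.Nonempty := card_pos.1 (by omega)
  obtain ⟨t₂, ht₂, hn₂⟩ : ∃ t₂ ∈ N, t₂ ∉ {t₁, v t₁} ∪ (P t₁ ∪ P (v t₁)) := by
    refine exists_mem_notMem_of_card_lt_card ?_
    have q1 := card_union_le (P t₁) (P (v t₁))
    have q2 := card_union_le ({t₁, v t₁} : Finset (Fin n)) (P t₁ ∪ P (v t₁))
    have q3 : ({t₁, v t₁} : Finset (Fin n)).card ≤ 2 := card_le_two
    have p1 := hP t₁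
    have p2 := hP (v t₁)
    omega
  obtain ⟨s, hs, hsn⟩ : ∃ s ∈ N, s ∉ X t₁ ∪ X t₂ := by
    refine exists_mem_notMem_of_card_lt_card ?_
    have q1 := card_union_le (X t₁) (X t₂)
    have p1 := hX t₁ ht₁
    have p2 := hX t₂ ht₂
    omega
  simp only [mem_union, not_or, mem_insert, mem_singleton] at hn₂ hsn
  have g1 := hgen t₁ ht₁ s hs hsn.1
  have g2 := hgen t₂ ht₂ s hs hsn.2
  have hP₂ := hPmem t₂ ht₂
  have k1 : v t₂ ≠ t₁ := fun h => hn₂.2.1 (h ▸ hP₂)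
  have k2 : v t₂ ≠ v t₁ := fun h => hn₂.2.2 (h ▸ hP₂)
  grind

end Conflicts

section Selection

variable {n d : ℕ} {𝓕 : Finset (Finset (Fin n))} {c : Finset (Fin n) → Finset (Fin n)}

/-- `F` is the first of the two sets of a conflict. -/
def IsConflicted (d K : ℕ) (𝓕 : Finset (Finset (Fin n))) (c : Finset (Fin n) → Finset (Fin n))
    (F : Finset (Fin n)) : Prop :=
  ∃ R t v u u', IsConflict d K 𝓕 c R t v u u' ∧ F = insert u (insert v (insert t R))

lemma isConflicted_of_common_subset {K : ℕ} (hcard : ∀ F ∈ 𝓕, F.card = d + 1)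
    {F F' D : Finset (Fin n)} (hF : F ∈ 𝓕) (hF' : F' ∈ 𝓕)
    (hd : (c F).card + 1 = d) (hd' : (c F').card + 1 = d) (hfull : IsFull d K 𝓕 (c F))
    (hfull' : IsFull d K 𝓕 (c F')) (hne : F ≠ F') (hcne : c F ≠ c F') (hD : D.card = d)
    (hDF : D ⊆ F) (hDF' : D ⊆ F') (hcD : c F ⊆ D) (hcD' : c F' ⊆ D) :
    IsConflicted d K 𝓕 c F := by
  obtain ⟨u, hu, huF⟩ := exists_eq_insert_iff.2 ⟨hDF, by rw [hcard F hF, hD]⟩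
  obtain ⟨u', hu', huF'⟩ := exists_eq_insert_iff.2 ⟨hDF', by rw [hcard F' hF', hD]⟩
  obtain ⟨v, hv, hvD⟩ := exists_eq_insert_iff.2 ⟨hcD, by rw [hd, hD]⟩
  obtain ⟨t, ht, htD⟩ := exists_eq_insert_iff.2 ⟨hcD', by rw [hd', hD]⟩
  have hcv : c F = D.erase v := by rw [← hvD, erase_insert hv]
  have hct : c F' = D.erase t := by rw [← htD, erase_insert ht]
  have hvm : v ∈ D := hvD ▸ mem_insert_self _ _
  have htm : t ∈ D := htD ▸ mem_insert_self _ _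
  have htv : t ≠ v := by
    rintro rfl
    exact hcne (hcv.trans hct.symm)
  have h1 : insert t ((D.erase t).erase v) = D.erase v := by
    rw [erase_right_comm, insert_erase (by simp [htv, htm])]
  have h2 : insert v ((D.erase t).erase v) = D.erase t :=
    insert_erase (by simp [htv.symm, hvm])
  have h3 : insert v (insert t ((D.erase t).erase v)) = D := by
    rw [h1, insert_erase hvm]
  refine ⟨(D.erase t).erase v, t, v, u, u', ?_, by rw [h3, huF]⟩
  refine { card_add := ?_, t_notMem := by simp, v_notMem := by simp, u_notMem := by simp [hu],
           u'_notMem := by simp [hu'], t_ne_v := htv, t_ne_u := ?_, t_ne_u' := ?_,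
           v_ne_u := ?_, v_ne_u' := ?_, u_ne_u' := ?_, left_mem := ?_, right_mem := ?_,
           cert_left := ?_, cert_right := ?_, full_left := ?_, full_right := ?_ }
  · rw [card_erase_of_mem (by simp [htv.symm, hvm]), card_erase_of_mem htm, hD]
    have : 1 < D.card := one_lt_card.2 ⟨t, htm, v, hvm, htv⟩
    omega
  · rintro rfl; exact hu htm
  · rintro rfl; exact hu' htm
  · rintro rfl; exact hu hvm
  · rintro rfl; exact hu' hvm
  · rintro rfl; exact hne (huF.symm.trans huF')
  · rw [h3, huF]; exact hF
  · rw [h3, huF']; exact hF'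
  · rw [h3, huF, h1, hcv]
  · rw [h3, huF', h2, hct]
  · rw [h1, ← hcv]; exact hfull
  · rw [h2, ← hct]; exact hfull'

open Classical in
lemma card_isConflicted_le {K : ℕ} (hcard : ∀ F ∈ 𝓕, F.card = d + 1)
    (hc : IsMaxCertAssignment 𝓕 c) :
    (𝓕.filter (IsConflicted d K 𝓕 c)).card ≤
      n ^ (d - 2) * (10 + 4 * K + 10 * ((d + 1) ^ (d + 1) * (d + 1))) * (d + 1) ^ (d + 1) := by
  set 𝓣 : Finset (Finset (Fin n)) := (powersetCard (d - 2) univ).biUnion (fun R =>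
    ((univ : Finset (Fin n)).filter
      (fun s => ∃ w z z', IsConflict d K 𝓕 c R s w z z')).image (fun s => insert s R)) with h𝓣
  have hsub : 𝓕.filter (IsConflicted d K 𝓕 c) ⊆ 𝓕.filter (fun F => c F ∈ 𝓣) := by
    intro F hF
    rw [mem_filter] at hF ⊢
    obtain ⟨hF, R, t, v, u, u', h, rfl⟩ := hF
    refine ⟨hF, ?_⟩
    rw [h.cert_left, h𝓣]
    simp only [mem_biUnion, mem_powersetCard, subset_univ, true_and, mem_image, mem_filter,
      mem_univ]
    exact ⟨R, by have := h.card_add; omega, t, ⟨v, u, u', h⟩, rfl⟩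
  refine (card_le_card hsub).trans ((card_filter_cert_mem_le hcard hc 𝓣).trans ?_)
  refine Nat.mul_le_mul_right _ ((card_biUnion_le_card_mul _ _ _ fun R _ =>
    card_image_le.trans (card_conflict_le hcard hc R)).trans ?_)
  exact Nat.mul_le_mul_right _ (card_powersetCard_univ_le _ _)

open Classical in
lemma card_not_isFull_le (hd : 2 ≤ d) (K : ℕ) :
    ((powersetCard (d - 1) univ).filter (fun T => ¬ IsFull d K 𝓕 T)).card * (K + 1) ≤
      (compShadow d 𝓕).card * d := by
  refine card_mul_le_card_mul (fun T D => T ⊆ D) ?_ ?_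
  · intro T hT
    have := (mem_filter.1 hT).2
    unfold IsFull at this
    rw [bipartiteAbove]
    convert Nat.succ_le_of_lt (not_le.1 this)
  · intro D hD
    have hDc : D.card = d := by
      simp only [compShadow, mem_sdiff, mem_powersetCard] at hD
      exact hD.1.2
    have hsub : bipartiteBelow (fun T D => T ⊆ D)
        ((powersetCard (d - 1) univ).filter (fun T => ¬ IsFull d K 𝓕 T)) D ⊆
        powersetCard (d - 1) D := by
      intro T hT
      simp only [bipartiteBelow, mem_filter, mem_powersetCard] at hT ⊢
      exact ⟨hT.2, hT.1.1.2⟩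
    refine (card_le_card hsub).trans ?_
    obtain ⟨e, rfl⟩ : ∃ e, d = e + 1 := ⟨d - 1, by omega⟩
    rw [card_powersetCard, hDc, Nat.add_sub_cancel, Nat.choose_succ_self_right]

/-- For every `u ∈ F \ c F`, the set `F ∪ {z} \ {u}` lies in `𝓕` and has a certificate of
size `d`. -/
def IsSwap (d : ℕ) (𝓕 : Finset (Finset (Fin n))) (c : Finset (Fin n) → Finset (Fin n))
    (F : Finset (Fin n)) (z : Fin n) : Prop :=
  z ∉ F ∧ ∀ u ∈ F \ c F, insert z (F.erase u) ∈ 𝓕 ∧ (c (insert z (F.erase u))).card = d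

open Classical in
noncomputable def swaps (d : ℕ) (𝓕 : Finset (Finset (Fin n)))
    (c : Finset (Fin n) → Finset (Fin n)) (F : Finset (Fin n)) : Finset (Fin n) :=
  univ.filter (IsSwap d 𝓕 c F)

lemma mem_swaps {F : Finset (Fin n)} {z : Fin n} : z ∈ swaps d 𝓕 c F ↔ IsSwap d 𝓕 c F z := by
  simp [swaps]

/-- The `d`-set `F \ {u}` is not claimed by another set with the same certificate, nor by a set
with a certificate through `y`. -/
def IsPrivate (d : ℕ) (𝓕 : Finset (Finset (Fin n))) (c : Finset (Fin n) → Finset (Fin n))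
    (y : Fin n) (F : Finset (Fin n)) (u : Fin n) : Prop :=
  u ∈ F \ c F ∧
  ¬ (insert y (F.erase u) ∈ 𝓕 ∧ (c (insert y (F.erase u))).card = d ∧
    y ∈ c (insert y (F.erase u))) ∧
  ∀ F' ∈ 𝓕, y ∉ F' → c F' = c F → F.erase u ⊆ F' → F' = F

lemma sdiff_cert_eq_pair (hcard : ∀ F ∈ 𝓕, F.card = d + 1) (hc : IsMaxCertAssignment 𝓕 c)
    {F : Finset (Fin n)} (hF : F ∈ 𝓕) (hd : (c F).card + 1 = d) {u : Fin n} (hu : u ∈ F \ c F) :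
    ∃ v, v ≠ u ∧ F \ c F = {u, v} := by
  have h2 : (F \ c F).card = 2 := by
    rw [card_sdiff_of_subset (cert_subset hc hF), hcard F hF]
    omega
  obtain ⟨a, b, hab, h⟩ := card_eq_two.1 h2
  rw [h] at hu ⊢
  rcases mem_insert.1 hu with rfl | hu
  · exact ⟨b, hab.symm, rfl⟩
  · rw [mem_singleton] at hu
    subst hu
    exact ⟨a, hab, pair_comm _ _⟩

set_option maxHeartbeats 800000 in
lemma isSwap_of_not_isPrivate {K : ℕ} (hn : K + d + 2 < n) (hcard : ∀ F ∈ 𝓕, F.card = d + 1)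
    (hc : IsMaxCertAssignment 𝓕 c) {F : Finset (Fin n)} {y : Fin n} (hF : F ∈ 𝓕)
    (hd : (c F).card + 1 = d) (hfull : IsFull d K 𝓕 (c F)) (hy : y ∉ F)
    (hno : ∀ u, ¬ IsPrivate d 𝓕 c y F u) : IsSwap d 𝓕 c F y := by
  classical
  refine ⟨hy, fun u hu => ?_⟩
  by_contra hcon
  have hno' := hno u
  unfold IsPrivate at hno'
  push Not at hno'
  obtain ⟨F', hF', hyF', hcF', hsub, hne⟩ := hno' hu (fun h1 h2 => absurd ⟨h1, h2⟩ hcon)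
  obtain ⟨v, hvu, hpair⟩ := sdiff_cert_eq_pair hcard hc hF hd hu
  have hvm : v ∈ F \ c F := by simp [hpair]
  rw [mem_sdiff] at hu hvm
  have hvF' : v ∈ F' := hsub (mem_erase.2 ⟨hvu, hvm.1⟩)
  obtain ⟨w, hwv, hpair'⟩ := sdiff_cert_eq_pair hcard hc hF' (by rw [hcF', hd])
    (show v ∈ F' \ c F' by rw [hcF', mem_sdiff]; exact ⟨hvF', hvm.2⟩)
  have hFeq : F = insert u (insert v (c F)) := by
    have : F = c F ∪ F \ c F := (union_sdiff_of_subset (cert_subset hc hF)).symm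
    rw [hpair] at this
    exact this.trans (by ext e; simp only [mem_union, mem_insert, mem_singleton]; tauto)
  have hFeq' : F' = insert v (insert w (c F)) := by
    have : F' = c F' ∪ F' \ c F' := (union_sdiff_of_subset (cert_subset hc hF')).symm
    rw [hpair', hcF'] at this
    exact this.trans (by ext e; simp only [mem_union, mem_insert, mem_singleton]; tauto)
  have hwc : w ∉ c F := by
    have : w ∈ F' \ c F' := by simp [hpair']
    rw [hcF', mem_sdiff] at this
    exact this.2
  have hwu : w ≠ u := by
    rintro rfl
    apply hne
    rw [hFeq']
    conv_rhs => rw [hFeq]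
    exact insert_comm _ _ _
  have hwF : w ∉ F := by
    rw [hFeq]
    simp [hwu, hwv, hwc]
  have hit : ∀ G ∈ 𝓕, c F ⊆ G → u ∈ G ∨ v ∈ G := by
    intro G hG h
    obtain ⟨a, haG, haF, hac⟩ := exists_mem_of_cert_subset hc hF hG h
    have : a ∈ F \ c F := mem_sdiff.2 ⟨haF, hac⟩
    rw [hpair] at this
    simp only [mem_insert, mem_singleton] at this
    rcases this with rfl | rfl
    · exact Or.inl haG
    · exact Or.inr haG
  have hit' : ∀ G ∈ 𝓕, c F ⊆ G → v ∈ G ∨ w ∈ G := by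
    intro G hG h
    obtain ⟨a, haG, haF, hac⟩ := exists_mem_of_cert_subset hc hF' hG (by rw [hcF']; exact h)
    have : a ∈ F' \ c F' := mem_sdiff.2 ⟨haF, hac⟩
    rw [hpair'] at this
    simp only [mem_insert, mem_singleton] at this
    rcases this with rfl | rfl
    · exact Or.inl haG
    · exact Or.inr haG
  have hvy : v ≠ y := fun h => hy (h ▸ hvm.1)
  have hwy : w ≠ y := fun h => hyF' (by rw [hFeq', h]; simp)
  have hcFv : c F ⊆ F.erase v := fun e he => mem_erase.2
    ⟨fun h => hvm.2 (h ▸ he), cert_subset hc hF he⟩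
  apply hno v
  refine ⟨mem_sdiff.2 hvm, ?_, ?_⟩
  · rintro ⟨hG, -, -⟩
    have := hit' _ hG (hcFv.trans (subset_insert _ _))
    simp [hvy, hwy, hwF] at this
  · intro F₂ hF₂ hyF₂ hcF₂ hsub₂
    by_contra hne₂
    have huF₂ : u ∈ F₂ := hsub₂ (mem_erase.2 ⟨hvu.symm, hu.1⟩)
    have hcsub₂ : c F ⊆ F₂ := hcFv.trans hsub₂
    have hvF₂ : v ∉ F₂ := fun h => hne₂ (by
      refine (eq_of_subset_of_card_le ?_ (by rw [hcard F hF, hcard F₂ hF₂])).symm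
      rw [hFeq]
      exact insert_subset huF₂ (insert_subset h hcsub₂))
    have hwF₂ : w ∈ F₂ := (hit' F₂ hF₂ hcsub₂).resolve_left hvF₂
    have hF₂eq : insert u (insert w (c F)) = F₂ := by
      refine eq_of_subset_of_card_le (insert_subset huF₂ (insert_subset hwF₂ hcsub₂)) ?_
      rw [hcard F₂ hF₂, card_insert_of_notMem (by simp [hwu.symm, hu.2]),
        card_insert_of_notMem hwc, hd]
    have hit₂ : ∀ G ∈ 𝓕, c F ⊆ G → u ∈ G ∨ w ∈ G := by
      intro G hG h
      obtain ⟨a, haG, haF, hac⟩ := exists_mem_of_cert_subset hc hF₂ hG (by rw [hcF₂]; exact h)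
      rw [hcF₂] at hac
      rw [← hF₂eq] at haF
      simp only [mem_insert, hac, or_false] at haF
      rcases haF with rfl | rfl
      · exact Or.inl haG
      · exact Or.inr haG
    have hmiss := card_missing_extension_le hfull
    have hFw : (insert w F).card ≤ d + 2 := by
      rw [card_insert_of_notMem hwF, hcard F hF]
    obtain ⟨z, -, hz⟩ : ∃ z ∈ (univ : Finset (Fin n)), z ∉ insert w F ∪
        (univ : Finset (Fin n)).filter (fun s => s ∉ c F ∧ insert s (c F) ∈ compShadow d 𝓕) := by
      refine exists_mem_notMem_of_card_lt_card ?_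
      refine (card_union_le _ _).trans_lt ?_
      rw [card_univ, Fintype.card_fin]
      omega
    simp only [mem_union, mem_insert, mem_filter, mem_univ, true_and, not_or, not_and] at hz
    have hzc : z ∉ c F := fun h => hz.1.2 (cert_subset hc hF h)
    obtain ⟨G, hG, r, -, rfl⟩ := exists_superset_of_notMem_compShadow hcard
      (by rw [card_insert_of_notMem hzc, hd]) (hz.2 hzc)
    have hcG : c F ⊆ insert r (insert z (c F)) :=
      (subset_insert _ _).trans (subset_insert _ _)
    have b1 := hit _ hG hcG
    have b2 := hit' _ hG hcG
    have b3 := hit₂ _ hG hcG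
    have hzu : u ≠ z := fun h => hz.1.2 (h ▸ hu.1)
    have hzv : v ≠ z := fun h => hz.1.2 (h ▸ hvm.1)
    have hzw : w ≠ z := fun h => hz.1.1 h.symm
    have key : ∀ e, e ≠ z → e ∉ c F → e ∈ insert r (insert z (c F)) → e = r := by
      intro e h1 h2 h3
      rcases mem_insert.1 h3 with h | h
      · exact h
      · exact absurd (mem_insert.1 h) (not_or.2 ⟨h1, h2⟩)
    have b1' := b1.imp (key u hzu hu.2) (key v hzv hvm.2)
    have b2' := b2.imp (key v hzv hvm.2) (key w hzw hwc)
    have b3' := b3.imp (key u hzu hu.2) (key w hzw hwc)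
    clear b1 b2 b3
    rcases b1' with h1 | h1
    · rcases b2' with h2 | h2
      · exact hvu (h2.trans h1.symm)
      · exact hwu (h2.trans h1.symm)
    · rcases b3' with h2 | h2
      · exact hvu (h1.trans h2.symm)
      · exact hwv (h2.trans h1.symm)

end Selection

section Kept

variable {n d : ℕ} {𝓕 : Finset (Finset (Fin n))} {c : Finset (Fin n) → Finset (Fin n)}

/-- The members of `𝓕` that are kept once the points `x` and `y` are removed. -/
def IsKept (d K L : ℕ) (𝓕 : Finset (Finset (Fin n))) (c : Finset (Fin n) → Finset (Fin n))
    (x y : Fin n) (F : Finset (Fin n)) : Prop :=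
  ((c F).card = d ∧ ¬ (x ∈ F ∧ y ∈ F)) ∨
  ((c F).card + 1 = d ∧ IsFull d K 𝓕 (c F) ∧ ¬ IsConflicted d K 𝓕 c F ∧ x ∉ F ∧ y ∉ F ∧
    ¬ ((swaps d 𝓕 c F).card < L ∧ y ∈ swaps d 𝓕 c F))

open Classical in
noncomputable def kept (d K L : ℕ) (𝓕 : Finset (Finset (Fin n)))
    (c : Finset (Fin n) → Finset (Fin n)) (x y : Fin n) : Finset (Finset (Fin n)) :=
  𝓕.filter (IsKept d K L 𝓕 c x y)

lemma mem_kept {K L : ℕ} {x y : Fin n} {F : Finset (Fin n)} :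
    F ∈ kept d K L 𝓕 c x y ↔ F ∈ 𝓕 ∧ IsKept d K L 𝓕 c x y F := by
  simp [kept]

/-- The set `S` is assigned to `F`. -/
def IsAssigned (d : ℕ) (𝓕 : Finset (Finset (Fin n))) (c : Finset (Fin n) → Finset (Fin n))
    (x y : Fin n) (F S : Finset (Fin n)) : Prop :=
  ((c F).card = d ∧ x ∉ c F ∧ y ∉ c F ∧ S = c F) ∨
  ((c F).card = d ∧ x ∈ c F ∧ S = (c F).erase x) ∨
  ((c F).card = d ∧ x ∉ c F ∧ y ∈ c F ∧ S = F.erase y) ∨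
  ((c F).card + 1 = d ∧ ∃ u, IsPrivate d 𝓕 c y F u ∧ S = F.erase u)

variable {K L : ℕ} {x y : Fin n}

lemma exists_isAssigned {F : Finset (Fin n)} (h : (c F).card = d) :
    ∃ S, IsAssigned d 𝓕 c x y F S := by
  by_cases hx : x ∈ c F
  · exact ⟨_, Or.inr (Or.inl ⟨h, hx, rfl⟩)⟩
  by_cases hy : y ∈ c F
  · exact ⟨_, Or.inr (Or.inr (Or.inl ⟨h, hx, hy, rfl⟩))⟩
  · exact ⟨_, Or.inl ⟨h, hx, hy, rfl⟩⟩

lemma IsAssigned.unique (hcard : ∀ F ∈ 𝓕, F.card = d + 1) (hc : IsMaxCertAssignment 𝓕 c)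
    {F F' S : Finset (Fin n)} (hF : F ∈ kept d K L 𝓕 c x y) (hF' : F' ∈ kept d K L 𝓕 c x y)
    (h : IsAssigned d 𝓕 c x y F S) (h' : IsAssigned d 𝓕 c x y F' S) : F = F' := by
  obtain ⟨hF, kF⟩ := mem_kept.1 hF
  obtain ⟨hF', kF'⟩ := mem_kept.1 hF'
  have case_a : ∀ {A B : Finset (Fin n)}, A ∈ 𝓕 → B ∈ 𝓕 → (c A).card = d → c A ⊆ B → A = B :=
    fun hA hB h1 h2 => (eq_of_cert_subset hcard hc hA hB h1 h2).symm
  have case_ab : ∀ {A B : Finset (Fin n)}, (c A).card = d → (c B).card = d → x ∈ c B →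
      c A ≠ (c B).erase x := by
    intro A B h1 h2 h3 h4
    have := card_erase_add_one h3
    rw [← h4] at this
    omega
  have case_b : ∀ {A B : Finset (Fin n)} {w : Fin n}, A ∈ 𝓕 → B ∈ 𝓕 → (c B).card = d →
      x ∈ c B → w ∈ A → (c B).erase x ≠ A.erase w := by
    intro A B w hA hB h1 h2 h3 h4
    have e1 := card_erase_add_one h2
    have e2 := card_erase_add_one h3
    rw [← h4, hcard A hA] at e2
    omega
  have case_cd : ∀ {A B : Finset (Fin n)} {u : Fin n}, A ∈ 𝓕 → (c A).card = d → y ∈ c A →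
      IsPrivate d 𝓕 c y B u → A.erase y ≠ B.erase u := by
    intro A B u hA h1 h2 h3 h4
    have h5 : insert y (B.erase u) = A := by
      rw [← h4, insert_erase (cert_subset hc hA h2)]
    apply h3.2.1
    rw [h5]
    exact ⟨hA, h1, h2⟩
  have hu_mem : ∀ {A : Finset (Fin n)} {u : Fin n}, IsPrivate d 𝓕 c y A u → u ∈ A :=
    fun h => (mem_sdiff.1 h.1).1
  rcases h with ⟨a1, a2, a3, rfl⟩ | ⟨a1, a2, rfl⟩ | ⟨a1, a2, a3, rfl⟩ | ⟨a1, u, a2, rfl⟩ <;>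
  rcases h' with ⟨b1, b2, b3, b4⟩ | ⟨b1, b2, b4⟩ | ⟨b1, b2, b3, b4⟩ | ⟨b1, v, b2, b4⟩
  · exact case_a hF hF' a1 (b4 ▸ cert_subset hc hF')
  · exact absurd b4 (case_ab a1 b1 b2)
  · exact case_a hF hF' a1 (b4 ▸ erase_subset _ _)
  · exact case_a hF hF' a1 (b4 ▸ erase_subset _ _)
  · exact absurd b4.symm (case_ab b1 a1 a2)
  · refine case_a hF hF' a1 ?_
    rw [← insert_erase a2, b4, insert_erase b2]
    exact cert_subset hc hF'
  · exact absurd b4 (case_b hF' hF a1 a2 (cert_subset hc hF' b3))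
  · exact absurd b4 (case_b hF' hF a1 a2 (hu_mem b2))
  · exact (case_a hF' hF b1 (b4 ▸ erase_subset _ _)).symm
  · exact absurd b4.symm (case_b hF hF' b1 b2 (cert_subset hc hF a3))
  · rw [← insert_erase (cert_subset hc hF a3), b4, insert_erase (cert_subset hc hF' b3)]
  · exact absurd b4 (case_cd hF a1 a3 b2)
  · exact (case_a hF' hF b1 (b4 ▸ erase_subset _ _)).symm
  · exact absurd b4.symm (case_b hF hF' b1 b2 (hu_mem a2))
  · exact absurd b4.symm (case_cd hF' b1 b3 a2)
  · have kF2 := kF.resolve_left (fun h => by omega)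
    have kF2' := kF'.resolve_left (fun h => by omega)
    by_contra hne
    by_cases hcc : c F' = c F
    · exact hne (a2.2.2 F' hF' kF2'.2.2.2.2.1 hcc (b4 ▸ erase_subset _ _)).symm
    · refine kF2.2.2.1 (isConflicted_of_common_subset hcard hF hF' a1 b1 kF2.2.1 kF2'.2.1 hne
        (fun h => hcc h.symm) (D := F.erase u) ?_ (erase_subset _ _) (b4 ▸ erase_subset _ _) ?_ ?_)
      · rw [card_erase_of_mem (hu_mem a2), hcard F hF, Nat.add_sub_cancel]
      · exact subset_erase.2 ⟨cert_subset hc hF, (mem_sdiff.1 a2.1).2⟩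
      · rw [b4]
        exact subset_erase.2 ⟨cert_subset hc hF', (mem_sdiff.1 b2.1).2⟩

lemma mem_famS_of_subset {V S G : Finset (Fin n)} {𝓗 : Finset (Finset (Fin n))}
    (hS : S.card = d) (hSV : S ⊆ V) (hG : G ∈ 𝓗) (hSG : S ⊆ G) (hGc : G.card = d + 1) :
    S ∈ famS d V 𝓗 := by
  simp only [famS, compShadow, shadow', mem_union, mem_sdiff, mem_powersetCard, mem_filter,
    mem_univ, true_and, subset_univ, not_and, not_not]
  exact Or.inr ⟨⟨hSV, hS⟩, fun _ => ⟨G, hG, hSG, by omega⟩⟩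

lemma subset_univ_sdiff_pair {S : Finset (Fin n)} (hx : x ∉ S) (hy : y ∉ S) :
    S ⊆ univ \ {x, y} := by
  intro e he
  simp only [mem_sdiff, mem_univ, true_and, mem_insert, mem_singleton, not_or]
  exact ⟨fun h => hx (h ▸ he), fun h => hy (h ▸ he)⟩

lemma IsAssigned.mem_famS (hcard : ∀ F ∈ 𝓕, F.card = d + 1)
    (hc : IsMaxCertAssignment 𝓕 c) {F S : Finset (Fin n)} (hF : F ∈ kept d K L 𝓕 c x y)
    (h : IsAssigned d 𝓕 c x y F S) : S ∈ famS d (univ \ {x, y}) (kept d K L 𝓕 c x y) := by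
  have hFk := hF
  obtain ⟨hF, kF⟩ := mem_kept.1 hF
  rcases h with ⟨a1, a2, a3, rfl⟩ | ⟨a1, a2, rfl⟩ | ⟨a1, a2, a3, rfl⟩ | ⟨a1, u, a2, rfl⟩
  · exact mem_famS_of_subset a1 (subset_univ_sdiff_pair a2 a3) hFk (cert_subset hc hF) (hcard F hF)
  · have kF1 := kF.resolve_right (fun h => by omega)
    have hyF : y ∉ F := fun h => kF1.2 ⟨cert_subset hc hF a2, h⟩
    simp only [famS, mem_union, mem_powersetCard]
    refine Or.inl ⟨subset_univ_sdiff_pair (by simp) ?_, by rw [card_erase_of_mem a2, a1]⟩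
    exact fun h => hyF (cert_subset hc hF (mem_of_mem_erase h))
  · have kF1 := kF.resolve_right (fun h => by omega)
    have hyF := cert_subset hc hF a3
    have hxF : x ∉ F := fun h => kF1.2 ⟨h, hyF⟩
    refine mem_famS_of_subset ?_ (subset_univ_sdiff_pair ?_ (by simp)) hFk (erase_subset _ _)
      (hcard F hF)
    · rw [card_erase_of_mem hyF, hcard F hF, Nat.add_sub_cancel]
    · exact fun h => hxF (mem_of_mem_erase h)
  · have kF2 := kF.resolve_left (fun h => by omega)
    refine mem_famS_of_subset ?_ (subset_univ_sdiff_pair ?_ ?_) hFk (erase_subset _ _)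
      (hcard F hF)
    · rw [card_erase_of_mem (mem_sdiff.1 a2.1).1, hcard F hF, Nat.add_sub_cancel]
    · exact fun h => kF2.2.2.2.1 (mem_of_mem_erase h)
    · exact fun h => kF2.2.2.2.2.1 (mem_of_mem_erase h)

/-- A set `c F ∪ {z}` with `z` a swap is not assigned to anything. -/
lemma IsAssigned.ne_insert_swap (hcard : ∀ F ∈ 𝓕, F.card = d + 1)
    (hc : IsMaxCertAssignment 𝓕 c) {F F' S : Finset (Fin n)} {z : Fin n} (hF : F ∈ 𝓕)
    (hd : (c F).card + 1 = d) (hy : y ∉ F) (hz : IsSwap d 𝓕 c F z) (hF' : F' ∈ 𝓕)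
    (h : IsAssigned d 𝓕 c x y F' S) : S ≠ insert z (c F) := by
  have hzc : z ∉ c F := fun h => hz.1 (cert_subset hc hF h)
  have hScard : (insert z (c F)).card = d := by rw [card_insert_of_notMem hzc, hd]
  rintro rfl
  have hsup : ∀ u ∈ F \ c F, insert z (c F) ⊆ insert z (F.erase u) := fun u hu =>
    insert_subset_insert _ (subset_erase.2 ⟨cert_subset hc hF, (mem_sdiff.1 hu).2⟩)
  have hzne : ∀ u ∈ F \ c F, u ≠ z := by
    rintro u hu rfl
    exact hz.1 (mem_sdiff.1 hu).1
  rcases h with ⟨a1, a2, a3, a4⟩ | ⟨a1, a2, a4⟩ | ⟨a1, a2, a3, a4⟩ | ⟨a1, w, a2, a4⟩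
  · obtain ⟨u, hu⟩ : (F \ c F).Nonempty := by
      rw [← card_pos, card_sdiff_of_subset (cert_subset hc hF), hcard F hF]
      omega
    obtain ⟨v, hvu, hpair⟩ := sdiff_cert_eq_pair hcard hc hF hd hu
    have hv : v ∈ F \ c F := by simp [hpair]
    have e1 := eq_of_cert_subset hcard hc hF' (hz.2 u hu).1 a1 (a4 ▸ hsup u hu)
    have e2 := eq_of_cert_subset hcard hc hF' (hz.2 v hv).1 a1 (a4 ▸ hsup v hv)
    have : v ∈ insert z (F.erase v) := by
      rw [e2, ← e1]
      exact mem_insert_of_mem (mem_erase.2 ⟨hvu, (mem_sdiff.1 hv).1⟩)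
    simp [hzne v hv] at this
  · have := card_erase_add_one a2
    rw [← a4] at this
    omega
  · have hsub : insert z (c F) ⊆ F' := a4 ▸ erase_subset _ _
    obtain ⟨a, haF', haF, hac⟩ := exists_mem_of_cert_subset hc hF hF'
      ((subset_insert _ _).trans hsub)
    have : a ∈ F'.erase y := mem_erase.2 ⟨fun h => hy (h ▸ haF), haF'⟩
    rw [← a4, mem_insert] at this
    rcases this with rfl | h
    · exact hz.1 haF
    · exact hac h
  · have hsub : insert z (c F) ⊆ F' := a4 ▸ erase_subset _ _
    obtain ⟨a, haF', haF, hac⟩ := exists_mem_of_cert_subset hc hF hF'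
      ((subset_insert _ _).trans hsub)
    have ha : a ∈ F \ c F := mem_sdiff.2 ⟨haF, hac⟩
    obtain ⟨b, hba, hpair⟩ := sdiff_cert_eq_pair hcard hc hF hd ha
    have hb : b ∈ F \ c F := by simp [hpair]
    have haS : a ∉ insert z (c F) := by simp [hac, hzne a ha]
    have hcard' : (insert a (insert z (c F))).card = d + 1 := by
      rw [card_insert_of_notMem haS, hScard]
    have e1 : insert a (insert z (c F)) = F' :=
      eq_of_subset_of_card_le (insert_subset haF' hsub) (by rw [hcard', hcard F' hF'])
    have e2 : insert a (insert z (c F)) = insert z (F.erase b) := by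
      refine eq_of_subset_of_card_le (insert_subset ?_ (hsup b hb)) ?_
      · exact mem_insert_of_mem (mem_erase.2 ⟨hba.symm, haF⟩)
      · rw [hcard', hcard _ (hz.2 b hb).1]
    have := (hz.2 b hb).2
    rw [← e2, e1] at this
    omega

lemma card_kept_le (hn : K + d + 2 < n) (hcard : ∀ F ∈ 𝓕, F.card = d + 1)
    (hc : IsMaxCertAssignment 𝓕 c) (hL : 2 ^ d * (d + 1) ^ (d + 1) + 2 ≤ L) :
    (kept d K L 𝓕 c x y).card ≤ (famS d (univ \ {x, y}) (kept d K L 𝓕 c x y)).card := by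
  classical
  set 𝓚 := kept d K L 𝓕 c x y with h𝓚
  set N := 𝓚.filter (fun F => ∃ S, IsAssigned d 𝓕 c x y F S) with hN
  set E := 𝓚.filter (fun F => ¬ ∃ S, IsAssigned d 𝓕 c x y F S) with hE
  have hsplit : N.card + E.card = 𝓚.card := card_filter_add_card_filter_not _
  have hEprop : ∀ F ∈ E, F ∈ 𝓕 ∧ (c F).card + 1 = d ∧ x ∉ F ∧ y ∉ F ∧
      L ≤ (swaps d 𝓕 c F).card := by
    intro F hF
    rw [hE, mem_filter, h𝓚, mem_kept] at hF
    obtain ⟨⟨hF, kF⟩, hno⟩ := hF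
    have kF2 := kF.resolve_left (fun h => hno (exists_isAssigned h.1))
    obtain ⟨k1, k2, k3, k4, k5, k6⟩ := kF2
    refine ⟨hF, k1, k4, k5, ?_⟩
    have hsw := isSwap_of_not_isPrivate hn hcard hc hF k1 k2 k5
      (fun u hu => hno ⟨_, Or.inr (Or.inr (Or.inr ⟨k1, u, hu, rfl⟩))⟩)
    by_contra hlt
    exact k6 ⟨not_le.1 hlt, mem_swaps.2 hsw⟩
  set rel : Finset (Fin n) → Finset (Fin n) → Prop := fun F S =>
    ∃ z ∈ swaps d 𝓕 c F \ {x, y}, insert z (c F) = S with hrel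
  set I := (univ : Finset (Finset (Fin n))).filter (fun S => ∃ F ∈ E, rel F S) with hI
  have hIcard : ∀ S ∈ I, S.card = d := by
    intro S hS
    rw [hI, mem_filter] at hS
    obtain ⟨-, F, hF, z, hz, rfl⟩ := hS
    obtain ⟨hF, k1, -⟩ := hEprop F hF
    rw [mem_sdiff, mem_swaps] at hz
    rw [card_insert_of_notMem (fun h => hz.1.1 (cert_subset hc hF h)), k1]
  have hIsub : I ⊆ famS d (univ \ {x, y}) 𝓚 := by
    intro S hS
    have hSc := hIcard S hS
    rw [hI, mem_filter] at hS
    obtain ⟨-, F, hF, z, hz, rfl⟩ := hS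
    obtain ⟨hF, k1, k4, k5, -⟩ := hEprop F hF
    simp only [mem_sdiff, mem_swaps, mem_insert, mem_singleton, not_or] at hz
    obtain ⟨hz, hzx, hzy⟩ := hz
    obtain ⟨u, hu⟩ : (F \ c F).Nonempty := by
      rw [← card_pos, card_sdiff_of_subset (cert_subset hc hF), hcard F hF]
      omega
    have hG := hz.2 u hu
    refine mem_famS_of_subset hSc (subset_univ_sdiff_pair ?_ ?_) (G := insert z (F.erase u)) ?_
      (insert_subset_insert _ (subset_erase.2 ⟨cert_subset hc hF, (mem_sdiff.1 hu).2⟩))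
      (hcard _ hG.1)
    · simp only [mem_insert, not_or]
      exact ⟨fun h => hzx h.symm, fun h => k4 (cert_subset hc hF h)⟩
    · simp only [mem_insert, not_or]
      exact ⟨fun h => hzy h.symm, fun h => k5 (cert_subset hc hF h)⟩
    · rw [h𝓚, mem_kept]
      refine ⟨hG.1, Or.inl ⟨hG.2, fun h => ?_⟩⟩
      simp [Ne.symm hzx, k4] at h
  have hEI : E.card * (2 ^ d * (d + 1) ^ (d + 1)) ≤ I.card * (2 ^ d * (d + 1) ^ (d + 1)) := by
    refine card_mul_le_card_mul rel ?_ ?_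
    · intro F hF
      obtain ⟨hF', k1, k4, k5, hLs⟩ := hEprop F hF
      have hsub : (swaps d 𝓕 c F \ {x, y}).image (fun z => insert z (c F)) ⊆
          bipartiteAbove rel I F := by
        intro S hS
        rw [mem_image] at hS
        rw [mem_bipartiteAbove, hI, mem_filter]
        exact ⟨⟨mem_univ _, F, hF, hS⟩, hS⟩
      refine le_trans ?_ (card_le_card hsub)
      rw [card_image_of_injOn]
      · have h1 := le_card_sdiff ({x, y} : Finset (Fin n)) (swaps d 𝓕 c F)
        have h2 : ({x, y} : Finset (Fin n)).card ≤ 2 := card_le_two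
        omega
      · intro z hz w hw hzw
        simp only [coe_sdiff, Set.mem_sdiff, mem_coe, mem_swaps] at hz hw
        have h1 : z ∈ insert w (c F) := by
          have h0 : z ∈ insert z (c F) := mem_insert_self _ _
          simpa only [hzw] using h0
        rcases mem_insert.1 h1 with h2 | h2
        · exact h2
        · exact absurd (cert_subset hc hF' h2) hz.1.1
    · intro S hS
      have hsub : bipartiteBelow rel E S ⊆ 𝓕.filter (fun F => c F ∈ S.powerset) := by
        intro F hF
        rw [mem_bipartiteBelow] at hF
        obtain ⟨hF, z, -, rfl⟩ := hF
        rw [mem_filter, mem_powerset]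
        exact ⟨(hEprop F hF).1, subset_insert _ _⟩
      refine (card_le_card hsub).trans ((card_filter_cert_mem_le hcard hc _).trans ?_)
      rw [card_powerset, hIcard S hS]
  have hEI' : E.card ≤ I.card := Nat.le_of_mul_le_mul_right hEI (by positivity)
  have hNI : N.card ≤ (famS d (univ \ {x, y}) 𝓚 \ I).card := by
    have hg : ∀ F ∈ N, ∃ S, IsAssigned d 𝓕 c x y F S := fun F hF => (mem_filter.1 hF).2
    choose! g hg using hg
    refine card_le_card_of_injOn g ?_ ?_
    · intro F hF
      have hFk := (mem_filter.1 (mem_coe.1 hF)).1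
      rw [mem_coe, mem_sdiff]
      refine ⟨(hg F hF).mem_famS hcard hc hFk, fun hS => ?_⟩
      rw [hI, mem_filter] at hS
      obtain ⟨-, F₀, hF₀, z, hz, hzS⟩ := hS
      obtain ⟨hF₀, k1, -, k5, -⟩ := hEprop F₀ hF₀
      rw [mem_sdiff, mem_swaps] at hz
      exact (hg F hF).ne_insert_swap hcard hc hF₀ k1 k5 hz.1 (mem_kept.1 hFk).1 hzS.symm
    · intro F hF F' hF' hgg
      have hFk := (mem_filter.1 (mem_coe.1 hF)).1
      have hFk' := (mem_filter.1 (mem_coe.1 hF')).1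
      exact IsAssigned.unique hcard hc hFk hFk' (hg F hF) (hgg ▸ hg F' hF')
  have := card_sdiff_add_card_eq_card hIsub
  omega

end Kept


section Choice

variable {n d : ℕ} {𝓕 : Finset (Finset (Fin n))} {c : Finset (Fin n) → Finset (Fin n)}

lemma card_filter_cert_card_le (hcard : ∀ F ∈ 𝓕, F.card = d + 1)
    (hc : IsMaxCertAssignment 𝓕 c) :
    (𝓕.filter (fun F => (c F).card + 1 = d)).card ≤ n ^ (d - 1) * (d + 1) ^ (d + 1) := by
  classical
  have hsub : 𝓕.filter (fun F => (c F).card + 1 = d) ⊆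
      𝓕.filter (fun F => c F ∈ powersetCard (d - 1) univ) := by
    intro F hF
    simp only [mem_filter, mem_powersetCard, subset_univ, true_and] at hF ⊢
    exact ⟨hF.1, by omega⟩
  refine (card_le_card hsub).trans ((card_filter_cert_mem_le hcard hc _).trans ?_)
  exact Nat.mul_le_mul_right _ (card_powersetCard_univ_le n (d - 1))

lemma card_filter_cert_card_le_le (hn : 1 ≤ n) (hcard : ∀ F ∈ 𝓕, F.card = d + 1)
    (hc : IsMaxCertAssignment 𝓕 c) (k : ℕ) :
    (𝓕.filter (fun F => (c F).card ≤ k)).card ≤ (k + 1) * n ^ k * (d + 1) ^ (d + 1) := by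
  classical
  have hsub : 𝓕.filter (fun F => (c F).card ≤ k) ⊆
      𝓕.filter (fun F => c F ∈ univ.filter (fun T : Finset (Fin n) => T.card ≤ k)) := by
    intro F hF
    simp only [mem_filter, mem_univ, true_and] at hF ⊢
    exact hF
  refine (card_le_card hsub).trans ((card_filter_cert_mem_le hcard hc _).trans ?_)
  exact Nat.mul_le_mul_right _ (card_filter_card_le_le hn k)

lemma cert_card_le (hcard : ∀ F ∈ 𝓕, F.card = d + 1) (hc : IsMaxCertAssignment 𝓕 c)
    {F : Finset (Fin n)} (hF : F ∈ 𝓕) : (c F).card ≤ d := by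
  have h1 := card_lt_card (hc F hF).1.1
  have h2 := hcard F hF
  omega

lemma card_family_le (hn : 1 ≤ n) (hcard : ∀ F ∈ 𝓕, F.card = d + 1)
    (hc : IsMaxCertAssignment 𝓕 c) :
    𝓕.card ≤ (d + 1) * n ^ d * (d + 1) ^ (d + 1) := by
  have := card_filter_cert_card_le_le hn hcard hc d
  rwa [filter_true_of_mem fun F hF => cert_card_le hcard hc hF] at this

lemma exists_good_pair (L : ℕ) (hn : 4 ≤ n) (hd : 2 ≤ d) (hcard : ∀ F ∈ 𝓕, F.card = d + 1)
    (hc : IsMaxCertAssignment 𝓕 c) :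
    ∃ x y : Fin n, x ≠ y ∧
      n * ((compShadow d 𝓕).filter (fun D => x ∈ D)).card ≤ 4 * (d * (compShadow d 𝓕).card) ∧
      n * ((compShadow d 𝓕).filter (fun D => y ∈ D)).card ≤ 4 * (d * (compShadow d 𝓕).card) ∧
      ((𝓕.filter (fun F => (c F).card + 1 = d)).filter (fun F => x ∈ F)).card ≤
        16 * ((d + 1) * (d + 1) ^ (d + 1)) * n ^ (d - 2) ∧
      ((𝓕.filter (fun F => (c F).card + 1 = d)).filter (fun F => y ∈ F)).card ≤
        16 * ((d + 1) * (d + 1) ^ (d + 1)) * n ^ (d - 2) ∧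
      ((𝓕.filter (fun F => x ∈ F)).filter (fun F => y ∈ F)).card ≤
        256 * ((d + 1) ^ 3 * (d + 1) ^ (d + 1)) * n ^ (d - 2) ∧
      (((𝓕.filter (fun F => (c F).card + 1 = d)).filter
        (fun F => (swaps d 𝓕 c F).card < L)).filter (fun F => y ∈ swaps d 𝓕 c F)).card ≤
        16 * (L * (d + 1) ^ (d + 1)) * n ^ (d - 2) := by
  set Q := (d + 1) ^ (d + 1) with hQ
  set P := 𝓕.filter (fun F => (c F).card + 1 = d) with hP
  have hpow1 : n ^ (d - 1) = n ^ (d - 2) * n := by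
    rw [← pow_succ]
    congr 1
    omega
  have hpow : n ^ d = n ^ (d - 2) * n * n := by
    rw [← pow_succ, ← pow_succ]
    congr 1
    omega
  have hn0 : 0 < n := by omega
  have hPcard : P.card ≤ n ^ (d - 2) * n * Q := hpow1 ▸ card_filter_cert_card_le hcard hc
  have hFcard : 𝓕.card ≤ (d + 1) * (n ^ (d - 2) * n * n) * Q :=
    hpow ▸ card_family_le (by omega) hcard hc
  have hP' : ∀ F ∈ P, F.card ≤ d + 1 := fun F hF => (hcard F (mem_filter.1 hF).1).le
  have hshadow : ∀ D ∈ compShadow d 𝓕, D.card ≤ d := fun D hD =>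
    (mem_powersetCard.1 (mem_sdiff.1 hD).1).2.le
  set P' := P.filter (fun F => (swaps d 𝓕 c F).card < L) with hP'def
  have b1 := card_high_degree_le (compShadow d 𝓕) (fun D => D) d 4 hshadow
  have b2 := card_high_degree_le P (fun F => F) (d + 1) 16 hP'
  have b3 := card_high_degree_le 𝓕 (fun F => F) (d + 1) 16 (fun F hF => (hcard F hF).le)
  have b4 := card_high_degree_le P' (swaps d 𝓕 c) L 16 (fun F hF => (mem_filter.1 hF).2.le)
  set B1 := (univ : Finset (Fin n)).filter (fun x => 4 * (d * (compShadow d 𝓕).card) <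
    n * ((compShadow d 𝓕).filter (fun D => x ∈ D)).card) with hB1
  set B2 := (univ : Finset (Fin n)).filter (fun x => 16 * ((d + 1) * P.card) <
    n * (P.filter (fun F => x ∈ F)).card) with hB2
  set B3 := (univ : Finset (Fin n)).filter (fun x => 16 * ((d + 1) * 𝓕.card) <
    n * (𝓕.filter (fun F => x ∈ F)).card) with hB3
  set B4 := (univ : Finset (Fin n)).filter (fun x => 16 * (L * P'.card) <
    n * (P'.filter (fun F => x ∈ swaps d 𝓕 c F)).card) with hB4
  obtain ⟨x, -, hx⟩ : ∃ x ∈ (univ : Finset (Fin n)), x ∉ B1 ∪ B2 ∪ B3 := by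
    refine exists_mem_notMem_of_card_lt_card ?_
    have h1 := card_union_le (B1 ∪ B2) B3
    have h2 := card_union_le B1 B2
    rw [card_univ, Fintype.card_fin]
    omega
  set Fx := 𝓕.filter (fun F => x ∈ F) with hFx
  have b5 := card_high_degree_le Fx (fun F => F) (d + 1) 16
    (fun F hF => (hcard F (mem_filter.1 hF).1).le)
  set B5 := (univ : Finset (Fin n)).filter (fun y => 16 * ((d + 1) * Fx.card) <
    n * (Fx.filter (fun F => y ∈ F)).card) with hB5
  obtain ⟨y, -, hy⟩ : ∃ y ∈ (univ : Finset (Fin n)), y ∉ B1 ∪ B2 ∪ B4 ∪ B5 ∪ {x} := by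
    refine exists_mem_notMem_of_card_lt_card ?_
    have h1 := card_union_le (B1 ∪ B2 ∪ B4 ∪ B5) {x}
    have h2 := card_union_le (B1 ∪ B2 ∪ B4) B5
    have h3 := card_union_le (B1 ∪ B2) B4
    have h4 := card_union_le B1 B2
    have h5 := card_singleton x
    rw [card_univ, Fintype.card_fin]
    omega
  simp only [mem_union, not_or, hB1, hB2, hB3, hB4, hB5, mem_filter, mem_univ, true_and, not_lt,
    mem_singleton] at hx hy
  obtain ⟨⟨x1, x2⟩, x3⟩ := hx
  obtain ⟨⟨⟨⟨y1, y2⟩, y4⟩, y5⟩, yx⟩ := hy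
  have hdegP : ∀ m : ℕ, n * m ≤ 16 * ((d + 1) * P.card) →
      m ≤ 16 * ((d + 1) * Q) * n ^ (d - 2) := by
    intro m hm
    refine Nat.le_of_mul_le_mul_left (hm.trans ?_) hn0
    calc 16 * ((d + 1) * P.card) ≤ 16 * ((d + 1) * (n ^ (d - 2) * n * Q)) := by gcongr
      _ = n * (16 * ((d + 1) * Q) * n ^ (d - 2)) := by ring
  refine ⟨x, y, fun h => yx h.symm, x1, y1, hdegP _ x2, hdegP _ y2, ?_, ?_⟩
  · refine Nat.le_of_mul_le_mul_left (Nat.le_of_mul_le_mul_left ?_ hn0) hn0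
    calc n * (n * (Fx.filter (fun F => y ∈ F)).card)
        ≤ n * (16 * ((d + 1) * Fx.card)) := by gcongr
      _ = 16 * (d + 1) * (n * Fx.card) := by ring
      _ ≤ 16 * (d + 1) * (16 * ((d + 1) * 𝓕.card)) := by gcongr
      _ ≤ 16 * (d + 1) * (16 * ((d + 1) * ((d + 1) * (n ^ (d - 2) * n * n) * Q))) := by gcongr
      _ = n * (n * (256 * ((d + 1) ^ 3 * Q) * n ^ (d - 2))) := by ring
  · refine Nat.le_of_mul_le_mul_left (y4.trans ?_) hn0
    calc 16 * (L * P'.card) ≤ 16 * (L * (n ^ (d - 2) * n * Q)) := by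
          gcongr
          exact (card_le_card (filter_subset _ _)).trans hPcard
      _ = n * (16 * (L * Q) * n ^ (d - 2)) := by ring

lemma card_sdiff_kept_le {K L : ℕ} {x y : Fin n} (hn : 1 ≤ n) (hd : 2 ≤ d)
    (hcard : ∀ F ∈ 𝓕, F.card = d + 1) (hc : IsMaxCertAssignment 𝓕 c) :
    (𝓕 \ kept d K L 𝓕 c x y).card ≤
      (d - 2 + 1) * n ^ (d - 2) * (d + 1) ^ (d + 1) +
      ((𝓕.filter (fun F => x ∈ F)).filter (fun F => y ∈ F)).card +
      (compShadow d 𝓕).card * d / (K + 1) * (d + 1) ^ (d + 1) +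
      n ^ (d - 2) * (10 + 4 * K + 10 * ((d + 1) ^ (d + 1) * (d + 1))) * (d + 1) ^ (d + 1) +
      ((𝓕.filter (fun F => (c F).card + 1 = d)).filter (fun F => x ∈ F)).card +
      ((𝓕.filter (fun F => (c F).card + 1 = d)).filter (fun F => y ∈ F)).card +
      (((𝓕.filter (fun F => (c F).card + 1 = d)).filter
        (fun F => (swaps d 𝓕 c F).card < L)).filter (fun F => y ∈ swaps d 𝓕 c F)).card := by
  classical
  set 𝓝 := (powersetCard (d - 1) (univ : Finset (Fin n))).filter (fun T => ¬ IsFull d K 𝓕 T)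
    with h𝓝
  have h𝓝card : (𝓕.filter (fun F => c F ∈ 𝓝)).card ≤
      (compShadow d 𝓕).card * d / (K + 1) * (d + 1) ^ (d + 1) := by
    refine (card_filter_cert_mem_le hcard hc 𝓝).trans (Nat.mul_le_mul_right _ ?_)
    rw [Nat.le_div_iff_mul_le (Nat.succ_pos K)]
    convert card_not_isFull_le (𝓕 := 𝓕) hd K
  have h1 := card_filter_cert_card_le_le hn hcard hc (d - 2)
  have h2 := card_isConflicted_le (K := K) hcard hc
  set A1 := 𝓕.filter (fun F => (c F).card ≤ d - 2)
  set A2 := (𝓕.filter (fun F => x ∈ F)).filter (fun F => y ∈ F)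
  set A3 := 𝓕.filter (fun F => c F ∈ 𝓝)
  set A4 := 𝓕.filter (IsConflicted d K 𝓕 c)
  set A5 := (𝓕.filter (fun F => (c F).card + 1 = d)).filter (fun F => x ∈ F)
  set A6 := (𝓕.filter (fun F => (c F).card + 1 = d)).filter (fun F => y ∈ F)
  set A7 := ((𝓕.filter (fun F => (c F).card + 1 = d)).filter
    (fun F => (swaps d 𝓕 c F).card < L)).filter (fun F => y ∈ swaps d 𝓕 c F)
  have hsub : 𝓕 \ kept d K L 𝓕 c x y ⊆ A1 ∪ A2 ∪ A3 ∪ A4 ∪ A5 ∪ A6 ∪ A7 := by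
    intro F hF
    rw [mem_sdiff, mem_kept] at hF
    obtain ⟨hF, hk⟩ := hF
    by_contra hcon
    simp only [A1, A2, A3, A4, A5, A6, A7, h𝓝, mem_union, mem_filter, not_or, hF, true_and,
      mem_powersetCard, subset_univ] at hcon
    obtain ⟨⟨⟨⟨⟨⟨a1, a2⟩, a3⟩, a4⟩, a5⟩, a6⟩, a7⟩ := hcon
    refine hk ⟨hF, ?_⟩
    have hle := cert_card_le hcard hc hF
    rcases Nat.lt_or_ge (c F).card d with hlt | hge
    · have hk1 : (c F).card + 1 = d := by omega
      refine Or.inr ⟨hk1, ?_, a4, fun h => a5 ⟨hk1, h⟩, fun h => a6 ⟨hk1, h⟩,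
        fun h => a7 ⟨⟨hk1, h.1⟩, h.2⟩⟩
      by_contra hnf
      exact a3 ⟨by omega, hnf⟩
    · exact Or.inl ⟨by omega, a2⟩
  have u0 := card_le_card hsub
  have u1 := card_union_le (A1 ∪ A2 ∪ A3 ∪ A4 ∪ A5 ∪ A6) A7
  have u2 := card_union_le (A1 ∪ A2 ∪ A3 ∪ A4 ∪ A5) A6
  have u3 := card_union_le (A1 ∪ A2 ∪ A3 ∪ A4) A5
  have u4 := card_union_le (A1 ∪ A2 ∪ A3) A4
  have u5 := card_union_le (A1 ∪ A2) A3
  have u6 := card_union_le A1 A2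
  omega

lemma card_filter_subset_ge {x y : Fin n} (hn : 0 < n) {𝓓 : Finset (Finset (Fin n))}
    (hx : n * (𝓓.filter (fun D => x ∈ D)).card ≤ 4 * (d * 𝓓.card))
    (hy : n * (𝓓.filter (fun D => y ∈ D)).card ≤ 4 * (d * 𝓓.card)) :
    ((𝓓.filter (fun D => D ⊆ univ \ {x, y})).card : ℝ) ≥ (1 - 8 * d / n) * (𝓓.card : ℝ) := by
  have hsub : 𝓓 ⊆ 𝓓.filter (fun D => D ⊆ univ \ {x, y}) ∪ 𝓓.filter (fun D => x ∈ D) ∪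
      𝓓.filter (fun D => y ∈ D) := by
    intro D hD
    simp only [mem_union, mem_filter, hD, true_and]
    by_cases hxD : x ∈ D
    · exact Or.inl (Or.inr hxD)
    by_cases hyD : y ∈ D
    · exact Or.inr hyD
    · exact Or.inl (Or.inl (subset_univ_sdiff_pair hxD hyD))
  have h1 := (card_le_card hsub).trans (card_union_le _ _)
  have h2 := h1.trans (Nat.add_le_add_right (card_union_le _ _) _)
  have hn' : (0 : ℝ) < n := by exact_mod_cast hn
  rw [ge_iff_le, sub_mul, one_mul, sub_le_iff_le_add, div_mul_eq_mul_div, ← sub_le_iff_le_add',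
    le_div_iff₀ hn']
  have h2' : (𝓓.card : ℝ) ≤ (𝓓.filter (fun D => D ⊆ univ \ {x, y})).card +
      (𝓓.filter (fun D => x ∈ D)).card + (𝓓.filter (fun D => y ∈ D)).card := by exact_mod_cast h2
  have hx' : (n : ℝ) * (𝓓.filter (fun D => x ∈ D)).card ≤ 4 * (d * 𝓓.card) := by exact_mod_cast hx
  have hy' : (n : ℝ) * (𝓓.filter (fun D => y ∈ D)).card ≤ 4 * (d * 𝓓.card) := by exact_mod_cast hy
  nlinarith [mul_le_mul_of_nonneg_left h2' hn'.le]

lemma exists_indicator_assignment {α : Type*} [DecidableEq α] {A B : Finset α}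
    (h : A.card ≤ B.card) :
    ∃ f : α → α → ℝ,
      (∀ F ∈ A, ∃ S ∈ B, f F = fun X => if X = S then (1 : ℝ) else 0) ∧
      ∀ S, ∑ F ∈ A, f F S ≤ 1 := by
  obtain ⟨B', hB', hcard⟩ := exists_subset_card_eq h
  let e := equivOfCardEq hcard.symm
  refine ⟨fun F X => if hF : F ∈ A then (if X = e ⟨F, hF⟩ then 1 else 0) else 0, ?_, ?_⟩
  · intro F hF
    exact ⟨e ⟨F, hF⟩, hB' (e ⟨F, hF⟩).2, by simp [hF]⟩
  · intro S
    rw [← sum_attach]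
    simp only [coe_mem, dite_true]
    rw [sum_boole]
    norm_cast
    rw [card_le_one]
    intro a ha b hb
    simp only [mem_filter] at ha hb
    exact e.injective (Subtype.ext (ha.2.symm.trans hb.2))

end Choice

theorem stmt11 (d : ℕ) (hd : 2 ≤ d) :
    ∃ C : ℝ, ∃ n₀ : ℕ, ∀ n : ℕ, n₀ ≤ n → ∀ 𝓕 : Finset (Finset (Fin n)),
      (∀ F ∈ 𝓕, F.card = d + 1) → VCDimLE 𝓕 d →
      ∃ V : Finset (Fin n), V.card = n - 2 ∧
      ∃ 𝓕₁ 𝓕₂ 𝓕₃ : Finset (Finset (Fin n)),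
        𝓕 = 𝓕₁ ∪ 𝓕₂ ∪ 𝓕₃ ∧ Disjoint 𝓕₁ 𝓕₂ ∧ Disjoint 𝓕₁ 𝓕₃ ∧ Disjoint 𝓕₂ 𝓕₃ ∧
        ∃ f : Finset (Fin n) → Finset (Fin n) → ℝ,
          -- (i)
          (((𝓕₁ ∪ 𝓕₂).card : ℝ) ≤ 0.1 * ((compShadow d 𝓕).card : ℝ) + C * n ^ (d - 2)) ∧
          ((((compShadow d (𝓕₂ ∪ 𝓕₃)).filter (fun D => D ⊆ V)).card : ℝ) ≥
            (1 - 8 * d / n) * ((compShadow d (𝓕₂ ∪ 𝓕₃)).card : ℝ)) ∧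
          -- (ii)
          (∀ F ∈ 𝓕₃,
            (∃ S ∈ famS d V 𝓕₃, f F = fun X => if X = S then (1 : ℝ) else 0) ∨
            (∃ S ∈ famS d V 𝓕₃, ∃ S' ∈ famS d V 𝓕₃, S ≠ S' ∧
              f F = fun X =>
                (if X = S then (1 : ℝ) / 2 else 0) + (if X = S' then (1 : ℝ) / 2 else 0))) ∧
          -- (iii)
          (∀ S ∈ famS d V 𝓕₃, ∑ F ∈ 𝓕₃, f F S ≤ 1) := by
  classical
  set Q := (d + 1) ^ (d + 1) with hQ
  set K := 10 * d * Q with hK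
  set L := 2 ^ d * Q + 2 with hL
  set C := (d - 2 + 1) * Q + 256 * ((d + 1) ^ 3 * Q) + (10 + 4 * K + 10 * (Q * (d + 1))) * Q +
    16 * ((d + 1) * Q) + 16 * ((d + 1) * Q) + 16 * (L * Q) with hC
  refine ⟨C, K + d + 10, fun n hn 𝓕 hcard hvc => ?_⟩
  obtain ⟨c, hc⟩ := exists_isMaxCertAssignment hcard hvc
  obtain ⟨x, y, hxy, hx, hy, hPx, hPy, hxyF, hswap⟩ :=
    exists_good_pair L (by omega) hd hcard hc
  have hbad := card_sdiff_kept_le (K := K) (L := L) (x := x) (y := y) (by omega) hd hcard hc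
  obtain ⟨f, hf, hsum⟩ := exists_indicator_assignment
    (card_kept_le (K := K) (L := L) (x := x) (y := y) (by omega) hcard hc le_rfl)
  have hsub : kept d K L 𝓕 c x y ⊆ 𝓕 := fun F hF => (mem_kept.1 hF).1
  have h𝓕 : 𝓕 \ kept d K L 𝓕 c x y ∪ kept d K L 𝓕 c x y = 𝓕 := sdiff_union_of_subset hsub
  refine ⟨univ \ {x, y}, ?_, ∅, 𝓕 \ kept d K L 𝓕 c x y, kept d K L 𝓕 c x y, ?_,
    disjoint_empty_left _, disjoint_empty_left _, sdiff_disjoint, f, ?_, ?_,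
    fun F hF => Or.inl (hf F hF), fun S _ => hsum S⟩
  · rw [card_sdiff_of_subset (subset_univ _), card_pair hxy, card_univ, Fintype.card_fin]
  · rw [empty_union, h𝓕]
  · rw [empty_union]
    have hfull : 10 * ((compShadow d 𝓕).card * d / (K + 1) * Q) ≤ (compShadow d 𝓕).card := by
      have h1 := Nat.div_mul_le_self ((compShadow d 𝓕).card * d) (K + 1)
      refine Nat.le_of_mul_le_mul_right (c := d) ?_ (by omega)
      refine le_trans ?_ h1
      rw [hK]
      nlinarith [Nat.zero_le ((compShadow d 𝓕).card * d / (10 * d * Q + 1))]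
    have hmain : (𝓕 \ kept d K L 𝓕 c x y).card ≤
        (compShadow d 𝓕).card * d / (K + 1) * Q + C * n ^ (d - 2) := by
      rw [hC]
      simp only [← hQ] at hbad hPx hPy hxyF hswap
      clear_value Q K L C
      linarith
    have hfull' : 10 * (((compShadow d 𝓕).card * d / (K + 1) * Q : ℕ) : ℝ) ≤
        (compShadow d 𝓕).card := by exact_mod_cast hfull
    have hmain' : ((𝓕 \ kept d K L 𝓕 c x y).card : ℝ) ≤
        (((compShadow d 𝓕).card * d / (K + 1) * Q : ℕ) : ℝ) + C * n ^ (d - 2) := by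
      exact_mod_cast hmain
    linarith
  · rw [h𝓕]
    exact card_filter_subset_ge (by omega) hx hy
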